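/- Let R be a commutative ring and let M, N be Lie algebras over R equipped with an action ψ^M_N of M on N and an action ψ^N_M of N on M. Then these actions are compatible if and only if there exist a Lie algebra L over R, morphisms of Lie algebras μ : M → L and ν : N → L, and actions ψ_M of L on M and ψ_N of L on N such that (μ, ψ_M) and (ν, ψ_N) are crossed modules of Lie algebras and the given actions are induced from L, i.e. ψ^M_N(m, n) = ψ_N(μ(m), n) and ψ^N_M(n, m) = ψ_M(ν(n), m) for all m ∈ M and n ∈ N. -/

import Mathlib

universe u v w

/-- An action of a Lie algebra `L` on a Lie algebra `M` over a commutative ring `R`: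
an `R`-bilinear map `act : L → M → M` satisfying
`act ⁅l,l'⁆ m = act l (act l' m) - act l' (act l m)` and
`act l ⁅m,m'⁆ = ⁅act l m, m'⁆ + ⁅m, act l m'⁆`. -/
structure LieAction (R : Type u) (L : Type v) (M : Type w) [CommRing R]
    [LieRing L] [LieAlgebra R L] [LieRing M] [LieAlgebra R M] where
  act : L → M → M
  add_left : ∀ (l l' : L) (m : M), act (l + l') m = act l m + act l' m
  smul_left : ∀ (r : R) (l : L) (m : M), act (r • l) m = r • act l m
  add_right : ∀ (l : L) (m m' : M), act l (m + m') = act l m + act l m'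
  smul_right : ∀ (r : R) (l : L) (m : M), act l (r • m) = r • act l m
  lie_act : ∀ (l l' : L) (m : M), act ⁅l, l'⁆ m = act l (act l' m) - act l' (act l m)
  act_lie : ∀ (l : L) (m m' : M), act l ⁅m, m'⁆ = ⁅act l m, m'⁆ + ⁅m, act l m'⁆

/-- A crossed module of Lie algebras `(∂ : M → L, ψ)`: the morphism `∂` is equivariant
for the action `ψ` of `L` on `M`, and the Peiffer identity holds. -/
structure IsLieCrossedModule {R : Type u} {L : Type v} {M : Type w} [CommRing R]
    [LieRing L] [LieAlgebra R L] [LieRing M] [LieAlgebra R M]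
    (d : M →ₗ⁅R⁆ L) (ψ : LieAction R L M) : Prop where
  equivariant : ∀ (l : L) (m : M), d (ψ.act l m) = ⁅l, d m⁆
  peiffer : ∀ (m m' : M), ψ.act (d m) m' = ⁅m, m'⁆

/-- Two actions of `M` on `N` and of `N` on `M` are *compatible* if
`ψMN (ψNM n m) n' = ⁅n', ψMN m n⁆` and `ψNM (ψMN m n) m' = ⁅m', ψNM n m⁆`. -/
def LieAction.Compatible {R : Type u} {M : Type v} {N : Type w} [CommRing R]
    [LieRing M] [LieAlgebra R M] [LieRing N] [LieAlgebra R N]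
    (ψMN : LieAction R M N) (ψNM : LieAction R N M) : Prop :=
  (∀ (m : M) (n n' : N), ψMN.act (ψNM.act n m) n' = ⁅n', ψMN.act m n⁆) ∧
  (∀ (n : N) (m m' : M), ψNM.act (ψMN.act m n) m' = ⁅m', ψNM.act n m⁆)

namespace LieHom

attribute [local instance] LieRing.ofAssociativeRing

variable {R L M : Type*} [CommRing R] [LieRing L] [LieAlgebra R L] [LieRing M] [LieAlgebra R M]

/-- Given a representation `ρ` of `L` on `M` and a morphism `f : M → L`, the elements `l` of `L`
for which `f` intertwines `ρ l` with `ad l`. -/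
def equivariantSubalgebra (ρ : L →ₗ⁅R⁆ Module.End R M) (f : M →ₗ⁅R⁆ L) : LieSubalgebra R L where
  carrier := {l | ∀ m, f (ρ l m) = ⁅l, f m⁆}
  add_mem' ha hb m := by simp [ha m, hb m]
  zero_mem' m := by simp
  smul_mem' r l hl m := by simp [hl m]
  lie_mem' {a b} ha hb m := by
    have ha' : ∀ m, f (ρ a m) = ⁅a, f m⁆ := ha
    have hb' : ∀ m, f (ρ b m) = ⁅b, f m⁆ := hb
    rw [LieHom.map_lie, LieRing.of_associative_ring_bracket, LinearMap.sub_apply,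
      Module.End.mul_apply, Module.End.mul_apply, map_sub, ha', hb', hb', ha', lie_lie]

/-- Restriction of the codomain of a morphism of Lie algebras to a Lie subalgebra. -/
def codRestrictSubalgebra (f : M →ₗ⁅R⁆ L) (K : LieSubalgebra R L) (h : ∀ m, f m ∈ K) :
    M →ₗ⁅R⁆ K where
  toLinearMap := f.toLinearMap.codRestrict K.toSubmodule h
  map_lie' {x y} := Subtype.ext (f.map_lie x y)

end LieHom

namespace LieAction

attribute [local instance] LieRing.ofAssociativeRing

variable {R L L' M N : Type*} [CommRing R] [LieRing L] [LieAlgebra R L] [LieRing L']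
  [LieAlgebra R L'] [LieRing M] [LieAlgebra R M] [LieRing N] [LieAlgebra R N]

/-- The representation underlying an action. -/
def toEnd (ψ : LieAction R L M) : L →ₗ⁅R⁆ Module.End R M where
  toFun l :=
    { toFun := ψ.act l
      map_add' := ψ.add_right l
      map_smul' := fun r => ψ.smul_right r l }
  map_add' l l' := LinearMap.ext (ψ.add_left l l')
  map_smul' r l := LinearMap.ext (ψ.smul_left r l)
  map_lie' {l l'} := LinearMap.ext (ψ.lie_act l l')

@[simp]
theorem toEnd_apply (ψ : LieAction R L M) (l : L) (m : M) : ψ.toEnd l m = ψ.act l m :=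
  rfl

theorem neg_left (ψ : LieAction R L M) (l : L) (m : M) : ψ.act (-l) m = -ψ.act l m := by
  simp [← toEnd_apply]

/-- A representation by derivations is an action. -/
def ofEnd (ρ : L →ₗ⁅R⁆ Module.End R M)
    (h : ∀ l m m', ρ l ⁅m, m'⁆ = ⁅ρ l m, m'⁆ + ⁅m, ρ l m'⁆) : LieAction R L M where
  act l m := ρ l m
  add_left := by simp
  smul_left := by simp
  add_right := by simp
  smul_right := by simp
  lie_act l l' m := by simp [LieRing.of_associative_ring_bracket]
  act_lie := h

/-- The pullback of an action along a morphism of Lie algebras. -/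
def comp (ψ : LieAction R L M) (f : L' →ₗ⁅R⁆ L) : LieAction R L' M :=
  ofEnd (ψ.toEnd.comp f) fun l => ψ.act_lie (f l)

@[simp]
theorem comp_act (ψ : LieAction R L M) (f : L' →ₗ⁅R⁆ L) (l : L') (m : M) :
    (ψ.comp f).act l m = ψ.act (f l) m :=
  rfl

/-- The mutual actions induced by two crossed modules over a common base satisfy the first
compatibility condition; the second follows by exchanging `M` and `N`. -/
theorem act_act_of_isLieCrossedModule {μ : M →ₗ⁅R⁆ L} {ν : N →ₗ⁅R⁆ L} {ψM : LieAction R L M}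
    {ψN : LieAction R L N} (hμ : IsLieCrossedModule μ ψM) (hν : IsLieCrossedModule ν ψN)
    (m : M) (n n' : N) :
    ψN.act (μ (ψM.act (ν n) m)) n' = ⁅n', ψN.act (μ m) n⁆ := by
  rw [hμ.equivariant, ← lie_skew, ← hν.equivariant, neg_left, hν.peiffer, lie_skew]

variable (ψMN : LieAction R M N) (ψNM : LieAction R N M)

/-- The morphism `m ↦ (ad m, ψMN m)`. -/
def leftToEndProd : M →ₗ⁅R⁆ Module.End R M × Module.End R N :=
  (LieAlgebra.ad R M).prod ψMN.toEnd

/-- The morphism `n ↦ (ψNM n, ad n)`. -/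
def rightToEndProd : N →ₗ⁅R⁆ Module.End R M × Module.End R N :=
  ψNM.toEnd.prod (LieAlgebra.ad R N)

/-- The pairs of endomorphisms of `M` and `N` with respect to which both `leftToEndProd` and
`rightToEndProd` are equivariant. -/
def baseSubalgebra : LieSubalgebra R (Module.End R M × Module.End R N) :=
  LieHom.equivariantSubalgebra (LieHom.fst R _ _) ψMN.leftToEndProd ⊓
    LieHom.equivariantSubalgebra (LieHom.snd R _ _) ψNM.rightToEndProd

variable {ψMN ψNM}

theorem leftToEndProd_mem (h : Compatible ψMN ψNM) (m : M) :
    ψMN.leftToEndProd m ∈ baseSubalgebra ψMN ψNM := by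
  refine ⟨fun m' => ψMN.leftToEndProd.map_lie m m', fun n => Prod.ext ?_ ?_⟩
  · ext m'
    change ψNM.act (ψMN.act m n) m' = ⁅m, ψNM.act n m'⁆ - ψNM.act n ⁅m, m'⁆
    rw [h.2, ψNM.act_lie, ← lie_skew]
    abel
  · ext n'
    change ⁅ψMN.act m n, n'⁆ = ψMN.act m ⁅n, n'⁆ - ⁅n, ψMN.act m n'⁆
    rw [ψMN.act_lie]
    abel

theorem rightToEndProd_mem (h : Compatible ψMN ψNM) (n : N) :
    ψNM.rightToEndProd n ∈ baseSubalgebra ψMN ψNM := by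
  refine ⟨fun m => Prod.ext ?_ ?_, fun n' => ψNM.rightToEndProd.map_lie n n'⟩
  · ext m'
    change ⁅ψNM.act n m, m'⁆ = ψNM.act n ⁅m, m'⁆ - ⁅m, ψNM.act n m'⁆
    rw [ψNM.act_lie]
    abel
  · ext n'
    change ψMN.act (ψNM.act n m) n' = ⁅n, ψMN.act m n'⁆ - ψMN.act m ⁅n, n'⁆
    rw [h.1, ψMN.act_lie, ← lie_skew]
    abel

variable (ψMN ψNM)

/-- The action of `baseSubalgebra` on `M` through the first component. -/
def baseActLeft : LieAction R (baseSubalgebra ψMN ψNM) M :=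
  ofEnd ((LieHom.fst R _ _).comp (baseSubalgebra ψMN ψNM).incl) fun l m m' => by
    have h : ⁅l.1.1 m, m'⁆ = l.1.1 ⁅m, m'⁆ - ⁅m, l.1.1 m'⁆ :=
      LinearMap.congr_fun (congrArg Prod.fst (l.2.1 m)) m'
    exact eq_add_of_sub_eq h.symm

/-- The action of `baseSubalgebra` on `N` through the second component. -/
def baseActRight : LieAction R (baseSubalgebra ψMN ψNM) N :=
  ofEnd ((LieHom.snd R _ _).comp (baseSubalgebra ψMN ψNM).incl) fun l n n' => by
    have h : ⁅l.1.2 n, n'⁆ = l.1.2 ⁅n, n'⁆ - ⁅n, l.1.2 n'⁆ :=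
      LinearMap.congr_fun (congrArg Prod.snd (l.2.2 n)) n'
    exact eq_add_of_sub_eq h.symm

variable {ψMN ψNM}

theorem isLieCrossedModule_baseActLeft (h : Compatible ψMN ψNM) :
    IsLieCrossedModule (ψMN.leftToEndProd.codRestrictSubalgebra _ (leftToEndProd_mem h))
      (baseActLeft ψMN ψNM) where
  equivariant l m := Subtype.ext (l.2.1 m)
  peiffer _ _ := rfl

theorem isLieCrossedModule_baseActRight (h : Compatible ψMN ψNM) :
    IsLieCrossedModule (ψNM.rightToEndProd.codRestrictSubalgebra _ (rightToEndProd_mem h))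
      (baseActRight ψMN ψNM) where
  equivariant l n := Subtype.ext (l.2.2 n)
  peiffer _ _ := rfl

end LieAction

/-- Crossed modules transport along isomorphisms of the base. -/
theorem IsLieCrossedModule.comp_equiv {R L L' M : Type*} [CommRing R] [LieRing L]
    [LieAlgebra R L] [LieRing L'] [LieAlgebra R L'] [LieRing M] [LieAlgebra R M]
    {d : M →ₗ⁅R⁆ L} {ψ : LieAction R L M} (h : IsLieCrossedModule d ψ) (e : L' ≃ₗ⁅R⁆ L) :
    IsLieCrossedModule (e.symm.toLieHom.comp d) (ψ.comp e.toLieHom) where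
  equivariant l m := e.injective (by simp [h.equivariant])
  peiffer m m' := by simp [h.peiffer]

/-- **Characterization of compatible actions** (Theorem 2.16 of the paper).
Two Lie algebras `M` and `N` acting on each other act compatibly if and only if there
exist a Lie algebra `L` and two crossed module structures `(μ : M → L, ψM)` and
`(ν : N → L, ψN)` such that the given actions are induced from the `L`-actions via
`μ` and `ν`. -/
theorem compatible_iff_exists_crossedModules
    (R : Type u) [CommRing R] (M N : Type v)
    [LieRing M] [LieAlgebra R M] [LieRing N] [LieAlgebra R N]
    (ψMN : LieAction R M N) (ψNM : LieAction R N M) :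
    LieAction.Compatible ψMN ψNM ↔
    ∃ (L : Type (max u v)) (_ : LieRing L) (_ : LieAlgebra R L)
      (μ : M →ₗ⁅R⁆ L) (ν : N →ₗ⁅R⁆ L)
      (ψM : LieAction R L M) (ψN : LieAction R L N),
      IsLieCrossedModule μ ψM ∧ IsLieCrossedModule ν ψN ∧
      (∀ (m : M) (n : N), ψMN.act m n = ψN.act (μ m) n) ∧
      (∀ (n : N) (m : M), ψNM.act n m = ψM.act (ν n) m) := by
  constructor
  · intro h
    let e : ULift.{u} (LieAction.baseSubalgebra ψMN ψNM) ≃ LieAction.baseSubalgebra ψMN ψNM :=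
      Equiv.ulift
    let := e.lieRing
    let := e.lieAlgebra R
    let f := e.lieEquiv R
    exact ⟨_, e.lieRing, e.lieAlgebra R, _, _, _, _,
      (LieAction.isLieCrossedModule_baseActLeft h).comp_equiv f,
      (LieAction.isLieCrossedModule_baseActRight h).comp_equiv f, fun _ _ => rfl, fun _ _ => rfl⟩
  · rintro ⟨L, _, _, μ, ν, ψM, ψN, hμ, hν, hMN, hNM⟩
    constructor
    · intro m n n'
      simpa only [hMN, hNM] using LieAction.act_act_of_isLieCrossedModule hμ hν m n n'
    · intro n m m'
      simpa only [hMN, hNM] using LieAction.act_act_of_isLieCrossedModule hν hμ n m m'
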